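/- arXiv:2001.10154 — 2 statements merged into one kernel-verified Lean document; each statement's English description precedes it below -/
import Mathlib

section
/- Let S1 = S(γ^((q-1)/d1), 0, H1) and S2 = S(γ^((q-1)/d2), 0, H2) be subgroups of AGL(1,F_q), where d1 | d2 | q-1, H1 ⊆ H2, and both triples (γ^((q-1)/d1), 0, H1) and (γ^((q-1)/d2), 0, H2) lie in S. Suppose d1 ≠ 1 and H1 is closed under multiplication by the subfield F_{p(d2)} of F_q. Then μ(S1, S2) = μ(d2/d1) · (-1)^l · p(d2)^(l(l-1)/2), where l is the dimension of H2/H1 as a vector space over F_{p(d2)} and μ(d2/d1) is the classical number-theoretic Möbius function evaluated at d2/d1. -/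
open Matrix
open scoped Classical

abbrev GL2 (F : Type) [Field F] := GL (Fin 2) F

/-- `AGL(1,F)`: the subgroup of `GL(2,F)` of matrices of the form `[[a,b],[0,1]]`. -/
def AGL (F : Type) [Field F] : Subgroup (GL2 F) where
  carrier := {g | (g : Matrix (Fin 2) (Fin 2) F) 1 0 = 0 ∧
                  (g : Matrix (Fin 2) (Fin 2) F) 1 1 = 1}
  one_mem' := by
    constructor <;> simp [Matrix.one_apply]
  mul_mem' := by
    rintro a b ⟨ha0, ha1⟩ ⟨hb0, hb1⟩
    constructor <;>
      simp [Units.val_mul, Matrix.mul_apply, Fin.sum_univ_two, ha0, ha1, hb0, hb1]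
  inv_mem' := by
    rintro g ⟨h0, h1⟩
    have hdet : ((g : Matrix (Fin 2) (Fin 2) F) 0 0) ≠ 0 := by
      have hu : IsUnit ((g : Matrix (Fin 2) (Fin 2) F).det) :=
        (Matrix.isUnit_iff_isUnit_det _).1 g.isUnit
      rw [Matrix.det_fin_two, h0, h1] at hu
      simpa using hu.ne_zero
    have hinv : ((g⁻¹ : GL2 F) : Matrix (Fin 2) (Fin 2) F)
        = ((g : Matrix (Fin 2) (Fin 2) F))⁻¹ := Matrix.coe_units_inv g
    constructor <;>
      simp [hinv, Matrix.inv_def, Matrix.adjugate_fin_two, Matrix.det_fin_two,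
        h0, h1, hdet]

/-- Membership of a triple `(a,b,H)` in the set `𝒮`: `a ∈ F*`, `H` is an additive
subgroup of `F` closed under multiplication by the subfield `F_p(a)` generated by `a`,
and `b = 0` when `a = 1`. -/
def memS {F : Type} [Field F] (a b : F) (H : AddSubgroup F) : Prop :=
  a ≠ 0 ∧ (a = 1 → b = 0) ∧ ∀ x ∈ Subfield.closure {a}, ∀ h ∈ H, x * h ∈ H

/-- `S(a,b,H)`: the subgroup of `GL(2,F)` generated by the matrix `[[a,b],[0,1]]`
together with the matrices `[[1,h],[0,1]]`, `h ∈ H`. -/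
def Sgrp {F : Type} [Field F] (a b : F) (H : AddSubgroup F) : Subgroup (GL2 F) :=
  Subgroup.closure {g : GL2 F |
    (g : Matrix (Fin 2) (Fin 2) F) = !![a, b; 0, 1] ∨
    ∃ h ∈ H, (g : Matrix (Fin 2) (Fin 2) F) = !![1, h; 0, 1]}

/-- `pPow p d` is `p(d)`: the smallest (positive) power of `p` that is `≡ 1 (mod d)`. -/
noncomputable def pPow (p d : ℕ) : ℕ := sInf {m | (∃ k : ℕ, 1 ≤ k ∧ m = p ^ k) ∧ m % d = 1 % d}


noncomputable def gw (Q k : ℕ) : ℤ := (-1) ^ k * (Q : ℤ) ^ (k * (k - 1) / 2)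

lemma gw_succ (Q k : ℕ) : gw Q (k+1) + (Q:ℤ)^k * gw Q k = 0 := by
  have h : (k+1) * (k + 1 - 1) / 2 = k + k * (k-1) / 2 := by
    have : (k+1) * (k + 1 - 1) = k * 2 + k * (k-1) := by
      cases k with
      | zero => rfl
      | succ n => simp; ring
    rw [this]; omega
  unfold gw
  rw [h, pow_succ, pow_add]; ring

section lin
variable {E V : Type} [Field E] [AddCommGroup V] [Module E V] [Fintype E] [Fintype V]

lemma card_fun (v : V) (hv : v ≠ 0) [Fintype (Module.Dual E V)] (k : ℕ) (hk : Module.finrank E V = k + 1) :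
    (Finset.univ.filter (fun f : Module.Dual E V => f v = 1)).card = Fintype.card E ^ k := by
  have hsurj : Function.Surjective (fun f : Module.Dual E V => f v) := by
    intro c
    obtain ⟨f, hf, -⟩ := Submodule.exists_dual_map_eq_bot_of_notMem (p := (⊥ : Submodule E V)) (x := v)
      (by simpa using hv) inferInstance
    exact ⟨(c / f v) • f, by simp [hf]⟩
  have hfib : ∀ c : E, (Finset.univ.filter (fun f : Module.Dual E V => f v = c)).card
      = (Finset.univ.filter (fun f : Module.Dual E V => f v = 1)).card := by
    intro c
    exact AddMonoidHom.card_fiber_eq_of_mem_range (Module.Dual.eval E V v) (hsurj c) (hsurj 1)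
  have h1 : Fintype.card (Module.Dual E V) = Fintype.card E ^ (k+1) := by
    rw [Module.card_eq_pow_finrank (K := E), Subspace.dual_finrank_eq, hk]
  have h2 := Finset.card_eq_sum_card_fiberwise (s := (Finset.univ : Finset (Module.Dual E V)))
    (t := (Finset.univ : Finset E)) (f := fun f => f v) (by intro _ _; simp)
  simp only [hfib, Finset.sum_const, smul_eq_mul, Finset.card_univ] at h2
  rw [h1, pow_succ, mul_comm] at h2
  exact (Nat.eq_of_mul_eq_mul_left Fintype.card_pos h2).symm

lemma fiber_zero [Fintype (Submodule E V)] (K : Submodule E V) (v : V) (hv : v ≠ 0) (hvK : v ∈ K) :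
    ∑ W ∈ Finset.univ.filter (fun W : Submodule E V => W ⊔ Submodule.span E {v} = K),
      gw (Fintype.card E) (Module.finrank E W) = 0 := by
  have : Fintype (Module.Dual E K) := by
    have : Finite (Module.Dual E K) := Module.finite_of_finite E
    exact Fintype.ofFinite _
  have hv' : (⟨v, hvK⟩ : K) ≠ 0 := by simpa using hv
  obtain ⟨k, hk⟩ : ∃ k, Module.finrank E K = k + 1 := by
    have : Nontrivial K := ⟨⟨_, _, hv'⟩⟩
    have : 0 < Module.finrank E K := Module.finrank_pos
    exact ⟨_, (Nat.succ_pred_eq_of_pos this).symm⟩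
  have hcard := card_fun (E := E) (⟨v, hvK⟩ : K) hv' k hk
  have hsplit : Finset.univ.filter (fun W : Submodule E V => W ⊔ Submodule.span E {v} = K)
      = insert K (Finset.univ.filter (fun W : Submodule E V => v ∉ W ∧ W ⊔ Submodule.span E {v} = K)) := by
    ext W
    simp only [Finset.mem_filter, Finset.mem_univ, true_and, Finset.mem_insert]
    constructor
    · intro h
      by_cases hW : v ∈ W
      · left
        rw [← h, eq_comm, sup_eq_left]
        simpa using hW
      · exact Or.inr ⟨hW, h⟩
    · rintro (rfl | h)
      · rw [sup_eq_left]; simpa using hvK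
      · exact h.2
  rw [hsplit, Finset.sum_insert (by simp [hvK]), hk]
  have : ∑ W ∈ Finset.univ.filter (fun W : Submodule E V => v ∉ W ∧ W ⊔ Submodule.span E {v} = K),
      gw (Fintype.card E) (Module.finrank E W)
      = ∑ f ∈ Finset.univ.filter (fun f : Module.Dual E K => f ⟨v, hvK⟩ = 1), gw (Fintype.card E) k := by
    symm
    refine Finset.sum_bij (fun f _ => (LinearMap.ker f).map K.subtype) ?_ ?_ ?_ ?_
    · intro f hf
      simp only [Finset.mem_filter, Finset.mem_univ, true_and] at hf ⊢
      constructor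
      · rintro ⟨x, hx, hxv⟩
        have : x = ⟨v, hvK⟩ := Subtype.ext hxv
        subst this
        have hx' : f ⟨v, hvK⟩ = 0 := hx
        rw [hf] at hx'
        exact one_ne_zero hx'
      · apply le_antisymm
        · rw [sup_le_iff]
          exact ⟨Submodule.map_subtype_le _ _, by simpa using hvK⟩
        · intro x hx
          rw [Submodule.mem_sup]
          refine ⟨x - f ⟨x, hx⟩ • v, ⟨⟨x, hx⟩ - f ⟨x, hx⟩ • ⟨v, hvK⟩, ?_, rfl⟩, f ⟨x, hx⟩ • v, ?_, by simp⟩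
          · rw [SetLike.mem_coe, LinearMap.mem_ker, map_sub, map_smul, hf]; simp
          · exact Submodule.smul_mem _ _ (Submodule.mem_span_singleton_self v)
    · intro f hf g hg hfg
      simp only [Finset.mem_filter, Finset.mem_univ, true_and] at hf hg
      have hfg' := Submodule.map_injective_of_injective K.injective_subtype hfg
      ext x
      have : x - f x • ⟨v, hvK⟩ ∈ LinearMap.ker f := by
        rw [LinearMap.mem_ker, map_sub, map_smul, hf]; simp
      rw [hfg'] at this
      have h2 : g x - f x * 1 = 0 := by
        rw [LinearMap.mem_ker, map_sub, map_smul, hg] at this; simpa using this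
      linear_combination -h2
    · intro W hW
      simp only [Finset.mem_filter, Finset.mem_univ, true_and] at hW
      obtain ⟨hvW, hWK⟩ := hW
      obtain ⟨f, hf, hfW⟩ := Submodule.exists_dual_map_eq_bot_of_notMem (p := W) (x := v)
        hvW inferInstance
      have hfW0 : ∀ w ∈ W, f w = 0 := by
        intro w hw
        have : f w ∈ W.map f := ⟨w, hw, rfl⟩
        rw [hfW] at this
        exact (Submodule.mem_bot E).1 this
      refine ⟨(f v)⁻¹ • (f ∘ₗ K.subtype), ?_, ?_⟩
      · simp [hf]
      · ext x
        constructor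
        · rintro ⟨y, hy, rfl⟩
          have hy' : f y = 0 := by
            have : (f v)⁻¹ * f y = 0 := hy
            simpa [hf] using this
          have hyK : (y : V) ∈ W ⊔ Submodule.span E {v} := hWK ▸ y.2
          obtain ⟨w, hw, z, hz, hwz⟩ := Submodule.mem_sup.1 hyK
          obtain ⟨c, rfl⟩ := Submodule.mem_span_singleton.1 hz
          rw [← hwz] at hy'
          have : c = 0 := by simpa [hfW0 w hw, hf] using hy'
          subst this
          simp only [zero_smul, add_zero] at hwz
          simpa [← hwz] using hw
        · intro hx
          have hxK : x ∈ K := hWK ▸ Submodule.mem_sup_left hx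
          refine ⟨⟨x, hxK⟩, ?_, rfl⟩
          simp [hfW0 x hx]
    · intro f hf
      simp only [Finset.mem_filter, Finset.mem_univ, true_and] at hf
      have hf0 : f ≠ 0 := by rintro rfl; simp at hf
      have := Module.Dual.finrank_ker_add_one_of_ne_zero hf0
      rw [LinearEquiv.finrank_eq (Submodule.equivMapOfInjective K.subtype K.injective_subtype (LinearMap.ker f)).symm]
      congr 1
      omega
  rw [this, Finset.sum_const, hcard, nsmul_eq_mul]
  push_cast
  exact gw_succ _ _

lemma sum_sub [Fintype (Submodule E V)] (K : Submodule E V) :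
    ∑ W ∈ Finset.univ.filter (fun W : Submodule E V => W ≤ K),
      gw (Fintype.card E) (Module.finrank E W) = if K = ⊥ then 1 else 0 := by
  split_ifs with h
  · subst h
    have : Finset.univ.filter (fun W : Submodule E V => W ≤ ⊥) = {⊥} := by
      ext; simp
    rw [this]; simp [gw]
  · obtain ⟨v, hvK, hv⟩ := Submodule.exists_mem_ne_zero_of_ne_bot h
    rw [← Finset.sum_fiberwise_of_maps_to (t := Finset.univ.filter (fun W : Submodule E V => W ≤ K ∧ v ∈ W))
      (g := fun W => W ⊔ Submodule.span E {v})]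
    · apply Finset.sum_eq_zero
      intro W hW
      simp only [Finset.mem_filter, Finset.mem_univ, true_and] at hW
      rw [← fiber_zero W v hv hW.2]
      apply Finset.sum_congr _ (fun _ _ => rfl)
      ext U
      simp only [Finset.mem_filter, Finset.mem_univ, true_and, and_iff_right_iff_imp]
      rintro rfl
      exact le_sup_left.trans hW.1
    · intro W hW
      simp only [Finset.mem_filter, Finset.mem_univ, true_and] at hW ⊢
      exact ⟨sup_le hW (by simpa using hvK), Submodule.mem_sup_right (Submodule.mem_span_singleton_self v)⟩

lemma card_comap_mkQ (N : Submodule E V) (W : Submodule E (V ⧸ N)) :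
    Nat.card (W.comap N.mkQ) = Nat.card N * Nat.card W := by
  have h := Submodule.card_eq_card_quotient_mul_card (LinearMap.ker ((N.mkQ.restrict (p := W.comap N.mkQ) (q := W) (fun x hx => hx))))
  rw [h]
  congr 1
  · refine Nat.card_congr ⟨fun x => ⟨x.1.1, ?_⟩, fun x => ⟨⟨x.1, ?_⟩, ?_⟩, fun x => rfl, fun x => rfl⟩
    · have := x.2
      rw [LinearMap.mem_ker, Subtype.ext_iff] at this
      exact (Submodule.Quotient.mk_eq_zero N).1 this
    · have : N.mkQ x.1 = 0 := by simp
      show N.mkQ x.1 ∈ W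
      rw [this]; exact W.zero_mem
    · rw [LinearMap.mem_ker, Subtype.ext_iff]
      simp
  · refine Nat.card_congr (LinearMap.quotKerEquivOfSurjective _ ?_).toEquiv
    rintro ⟨w, hw⟩
    obtain ⟨x, rfl⟩ := N.mkQ_surjective w
    exact ⟨⟨x, hw⟩, rfl⟩

lemma sum_Icc [Fintype (Submodule E V)] (N K : Submodule E V) (hNK : N ≤ K) :
    ∑ W ∈ Finset.univ.filter (fun W : Submodule E V => N ≤ W ∧ W ≤ K),
      gw (Fintype.card E) (Nat.log (Fintype.card E) (Nat.card W / Nat.card N)) = if N = K then 1 else 0 := by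
  have : Fintype (V ⧸ N) := Fintype.ofFinite _
  have : Fintype (Submodule E (V ⧸ N)) := Fintype.ofFinite _
  have h := sum_sub (E := E) (K.map N.mkQ)
  have e : (K.map N.mkQ = ⊥) ↔ N = K := by
    rw [eq_bot_iff, Submodule.map_le_iff_le_comap, Submodule.comap_bot, Submodule.ker_mkQ]
    exact ⟨fun h => le_antisymm hNK h, fun h => h.ge⟩
  simp only [e] at h
  rw [← h]
  symm
  refine Finset.sum_bij (fun W _ => W.comap N.mkQ) ?_ ?_ ?_ ?_
  · intro W hW
    simp only [Finset.mem_filter, Finset.mem_univ, true_and] at hW ⊢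
    refine ⟨fun x hx => ?_, ?_⟩
    · have : N.mkQ x = 0 := by simpa using hx
      show N.mkQ x ∈ W
      rw [this]; exact W.zero_mem
    · refine (Submodule.comap_mono hW).trans ?_
      rw [Submodule.comap_map_mkQ]
      exact sup_le hNK le_rfl
  · intro W _ U _ h
    exact Submodule.comap_injective_of_surjective N.mkQ_surjective h
  · intro W hW
    simp only [Finset.mem_filter, Finset.mem_univ, true_and] at hW ⊢
    refine ⟨W.map N.mkQ, Submodule.map_mono hW.2, ?_⟩
    rw [Submodule.comap_map_mkQ]
    exact sup_eq_right.2 hW.1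
  · intro W _
    rw [card_comap_mkQ, Nat.mul_div_cancel_left _ Nat.card_pos, Nat.card_eq_fintype_card,
      Module.card_eq_pow_finrank (K := E) (V := W), Nat.log_pow]
    exact Fintype.one_lt_card
end lin

lemma moeb_sum (d1 d0 : ℕ) (h0 : d0 ≠ 0) (h : d1 ∣ d0) :
    ∑ d ∈ d0.divisors.filter (fun d => d1 ∣ d), ArithmeticFunction.moebius (d / d1)
      = if d1 = d0 then 1 else 0 := by
  obtain ⟨e, rfl⟩ := h
  have hd1 : 0 < d1 := Nat.pos_of_ne_zero (by rintro rfl; simp at h0)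
  have he : e ≠ 0 := by rintro rfl; simp at h0
  have h1 : ∑ d ∈ e.divisors, ArithmeticFunction.moebius d = if e = 1 then 1 else 0 := by
    rw [← ArithmeticFunction.coe_zeta_mul_apply, ArithmeticFunction.coe_zeta_mul_moebius,
      ArithmeticFunction.one_apply]
  have h2 : (d1 = d1 * e) ↔ e = 1 := by
    constructor
    · intro h
      exact (Nat.eq_of_mul_eq_mul_left hd1 (by rw [← h, mul_one])).symm.symm
    · rintro rfl; simp
  simp only [h2]
  rw [← h1]
  symm
  refine Finset.sum_bij (fun d _ => d1 * d) ?_ ?_ ?_ ?_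
  · intro d hd
    simp only [Nat.mem_divisors, Finset.mem_filter] at hd ⊢
    exact ⟨⟨mul_dvd_mul_left _ hd.1, h0⟩, dvd_mul_right _ _⟩
  · intro d _ d' _ h
    exact Nat.eq_of_mul_eq_mul_left hd1 h
  · intro d hd
    simp only [Nat.mem_divisors, Finset.mem_filter] at hd
    obtain ⟨⟨h3, _⟩, c, rfl⟩ := hd
    refine ⟨c, ?_, rfl⟩
    simp only [Nat.mem_divisors]
    exact ⟨Nat.dvd_of_mul_dvd_mul_left hd1 h3, he⟩
  · intro d _
    rw [Nat.mul_div_cancel_left _ hd1]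

section fld
variable {F : Type} [Field F] [Fintype F]

lemma closed_closure (a : F) (H : AddSubgroup F) (hH : ∀ h ∈ H, a * h ∈ H) :
    ∀ x ∈ Subfield.closure {a}, ∀ h ∈ H, x * h ∈ H := by
  intro x hx
  induction hx using Subfield.closure_induction with
  | mem x hx => rw [Set.mem_singleton_iff] at hx; subst hx; exact hH
  | one => intro h hh; simpa using hh
  | add x y _ _ hx hy => intro h hh; rw [add_mul]; exact H.add_mem (hx h hh) (hy h hh)
  | neg x _ hx => intro h hh; rw [neg_mul]; exact H.neg_mem (hx h hh)
  | mul x y _ _ hx hy => intro h hh; rw [mul_assoc]; exact hx _ (hy h hh)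
  | inv x _ hx =>
    intro h hh
    by_cases h0 : x = 0
    · subst h0; simp
    have hpow : ∀ n : ℕ, ∀ h ∈ H, x ^ n * h ∈ H := by
      intro n
      induction n with
      | zero => intro h hh; simpa using hh
      | succ n ih => intro h hh; rw [pow_succ, mul_assoc]; exact ih _ (hx h hh)
    have : x⁻¹ = x ^ (Fintype.card F - 2) := by
      have h1 := FiniteField.pow_card_sub_one_eq_one x h0
      have h2 : 1 < Fintype.card F := Fintype.one_lt_card
      have h3 : Fintype.card F - 1 = Fintype.card F - 2 + 1 := by omega
      rw [h3, pow_succ] at h1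
      exact (eq_inv_of_mul_eq_one_left h1).symm
    rw [this]; exact hpow _ h hh

lemma card_closure (p : ℕ) (hp : p.Prime) (hchar : ringChar F = p) (a : F) (d : ℕ)
    (ha : orderOf a = d) (hd : 0 < d) : Nat.card (Subfield.closure {a}) = pPow p d := by
  have : Fact p.Prime := ⟨hp⟩
  have hcF : CharP F p := hchar ▸ ringChar.charP F
  have ha0 : a ≠ 0 := by
    rintro rfl
    have := pow_orderOf_eq_one (0 : F)
    rw [ha, zero_pow hd.ne'] at this
    exact zero_ne_one this
  set K := Subfield.closure {a} with hK
  have hmem : Nat.card K ∈ {m | (∃ k : ℕ, 1 ≤ k ∧ m = p ^ k) ∧ m % d = 1 % d} := by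
    have : CharP K p := inferInstance
    have : Fintype K := Fintype.ofFinite _
    refine ⟨?_, ?_⟩
    · obtain ⟨n, _, hn⟩ := FiniteField.card K p
      exact ⟨n, n.2, by rw [Nat.card_eq_fintype_card, hn]⟩
    · have haK : a ∈ K := Subfield.subset_closure rfl
      have h1 := FiniteField.pow_card_sub_one_eq_one (⟨a, haK⟩ : K) (by
        intro h; exact ha0 (congrArg Subtype.val h))
      have h2 : a ^ (Fintype.card K - 1) = 1 := by
        have := congrArg Subtype.val h1
        simpa using this
      have h3 := orderOf_dvd_of_pow_eq_one h2
      rw [ha] at h3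
      rw [Nat.card_eq_fintype_card]
      exact ((Nat.modEq_iff_dvd' Fintype.card_pos).2 h3).symm
  refine le_antisymm ?_ (Nat.sInf_le hmem)
  refine le_csInf ⟨_, hmem⟩ ?_
  rintro m ⟨⟨k, hk, rfl⟩, hm⟩
  have hak : a ^ (p ^ k) = a := by
    have h1 : 1 ≤ p ^ k := Nat.one_le_pow _ _ hp.pos
    have h3 : d ∣ p ^ k - 1 := (Nat.modEq_iff_dvd' h1).1 (Eq.symm hm)
    rw [← ha, orderOf_dvd_iff_pow_eq_one] at h3
    have h4 : p ^ k = p ^ k - 1 + 1 := by omega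
    rw [h4, pow_succ, h3, one_mul]
  have hle : ∀ x ∈ K, x ^ (p ^ k) = x := by
    intro x hx
    have : K ≤ RingHom.eqLocusField (iterateFrobenius F p k) (RingHom.id F) := by
      rw [hK, Subfield.closure_le]
      rintro _ rfl
      exact hak
    exact this hx
  have h1 : 1 < p ^ k := Nat.one_lt_pow (by omega) hp.one_lt
  have hne : (Polynomial.X ^ (p ^ k) - Polynomial.X : Polynomial F) ≠ 0 :=
    FiniteField.X_pow_card_sub_X_ne_zero F h1
  have hdeg : (Polynomial.X ^ (p ^ k) - Polynomial.X : Polynomial F).natDegree = p ^ k :=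
    FiniteField.X_pow_card_sub_X_natDegree_eq F h1
  have hsub : (K : Set F).toFinset ⊆ (Polynomial.X ^ (p ^ k) - Polynomial.X : Polynomial F).roots.toFinset := by
    intro x hx
    have hx : x ∈ K := by simpa using hx
    rw [Multiset.mem_toFinset, Polynomial.mem_roots hne]
    simp [hle x hx]
  calc Nat.card K = (K : Set F).toFinset.card := by
        rw [Set.toFinset_card, ← Nat.card_eq_fintype_card]; rfl
    _ ≤ _ := Finset.card_le_card hsub
    _ ≤ _ := Multiset.toFinset_card_le _
    _ ≤ _ := Polynomial.card_roots' _
    _ = _ := hdeg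

lemma inn_sum [Fintype (AddSubgroup F)] (a : F) (H1 H0 : AddSubgroup F) (h10 : H1 ≤ H0)
    (c1 : ∀ h ∈ H1, a * h ∈ H1) (c0 : ∀ h ∈ H0, a * h ∈ H0) (Q : ℕ)
    (hQ : Nat.card (Subfield.closure {a}) = Q) :
    ∑ H ∈ Finset.univ.filter (fun H : AddSubgroup F => (H1 ≤ H ∧ H ≤ H0) ∧ ∀ h ∈ H, a * h ∈ H),
      gw Q (Nat.log Q (Nat.card H / Nat.card H1)) = if H1 = H0 then 1 else 0 := by
  let K := Subfield.closure {a}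
  have : Fintype K := Fintype.ofFinite _
  have : Fintype (Submodule K F) := Fintype.ofFinite _
  let sm (H : AddSubgroup F) (hH : ∀ h ∈ H, a * h ∈ H) : Submodule K F :=
    { H with smul_mem' := fun c x hx => closed_closure a H hH c c.2 x hx }
  have h := sum_Icc (sm H1 c1) (sm H0 c0) h10
  have e : sm H1 c1 = sm H0 c0 ↔ H1 = H0 := by
    constructor
    · intro h
      ext x
      exact (SetLike.ext_iff.1 h x : _)
    · rintro rfl; rfl
  have hQ' : Fintype.card K = Q := by rw [← hQ, Nat.card_eq_fintype_card]
  simp only [e] at h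
  rw [← h, hQ']
  symm
  refine Finset.sum_bij (fun W _ => W.toAddSubgroup) ?_ ?_ ?_ ?_
  · intro W hW
    simp only [Finset.mem_filter, Finset.mem_univ, true_and] at hW ⊢
    refine ⟨⟨hW.1, hW.2⟩, fun h hh => ?_⟩
    exact W.smul_mem (⟨a, Subfield.subset_closure rfl⟩ : K) hh
  · intro W _ U _ h
    exact Submodule.toAddSubgroup_injective h
  · intro H hH
    simp only [Finset.mem_filter, Finset.mem_univ, true_and] at hH
    exact ⟨sm H hH.2, by simp only [Finset.mem_filter, Finset.mem_univ, true_and]; exact ⟨hH.1.1, hH.1.2⟩, rfl⟩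
  · intro W _
    rfl
end fld

section grp
variable {F : Type} [Field F] [Fintype F]

noncomputable def affE (x : Fˣ) (b : F) : GL2 F :=
  GeneralLinearGroup.mkOfDetNeZero !![(x : F), b; 0, 1] (by simp [Matrix.det_fin_two])

lemma affE_val (x : Fˣ) (b : F) : (affE x b : Matrix (Fin 2) (Fin 2) F) = !![(x : F), b; 0, 1] := rfl

lemma affE_mul (x y : Fˣ) (b c : F) : affE x b * affE y c = affE (x * y) (x * c + b) := by
  apply Units.ext
  rw [Units.val_mul, affE_val, affE_val, affE_val]
  simp

lemma affE_one : affE (1 : Fˣ) 0 = 1 := by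
  apply Units.ext
  rw [affE_val]
  ext i j
  fin_cases i <;> fin_cases j <;> simp

lemma affE_inv (x : Fˣ) (b : F) : (affE x b)⁻¹ = affE x⁻¹ (-(x⁻¹ : Fˣ) * b) := by
  rw [inv_eq_iff_mul_eq_one, affE_mul, ← affE_one]
  simp

lemma affE_inj {x y : Fˣ} {b c : F} (h : affE x b = affE y c) : x = y ∧ b = c := by
  have h' := congrArg (fun g : GL2 F => (g : Matrix (Fin 2) (Fin 2) F)) h
  simp only [affE_val] at h'
  refine ⟨Units.ext ?_, ?_⟩
  · simpa using congrFun (congrFun h' 0) 0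
  · simpa using congrFun (congrFun h' 0) 1

lemma affE_eq {x : Fˣ} {b : F} {g : GL2 F} (h : (g : Matrix (Fin 2) (Fin 2) F) = !![(x : F), b; 0, 1]) :
    g = affE x b := Units.ext h

lemma pow_closed (a : F) (H : AddSubgroup F) (hH : ∀ h ∈ H, a * h ∈ H) (n : ℕ) :
    ∀ h ∈ H, a ^ n * h ∈ H := by
  induction n with
  | zero => intro h hh; simpa using hh
  | succ n ih => intro h hh; rw [pow_succ, mul_assoc]; exact ih _ (hH h hh)

lemma mem_Sgrp (a : Fˣ) (H : AddSubgroup F) (hH : ∀ h ∈ H, (a : F) * h ∈ H) (g : GL2 F) :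
    g ∈ Sgrp (a : F) 0 H ↔ ∃ i : ℕ, ∃ h ∈ H, g = affE (a ^ i) h := by
  constructor
  · intro hg
    let T : Subgroup (GL2 F) :=
      { carrier := {g | ∃ i : ℕ, ∃ h ∈ H, g = affE (a ^ i) h}
        one_mem' := ⟨0, 0, H.zero_mem, by rw [pow_zero, affE_one]⟩
        mul_mem' := by
          rintro _ _ ⟨i, h, hh, rfl⟩ ⟨j, k, hk, rfl⟩
          refine ⟨i + j, (a ^ i : Fˣ) * k + h, H.add_mem ?_ hh, by rw [affE_mul, pow_add]⟩
          rw [Units.val_pow_eq_pow_val]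
          exact pow_closed _ H hH i k hk
        inv_mem' := by
          rintro _ ⟨i, h, hh, rfl⟩
          have e : ((a ^ i)⁻¹ : Fˣ) = a ^ ((orderOf a - 1) * i) := by
            rw [pow_mul, inv_eq_iff_mul_eq_one, ← mul_pow]
            have : a * a ^ (orderOf a - 1) = 1 := by
              rw [← pow_succ', Nat.sub_add_cancel (orderOf_pos a), pow_orderOf_eq_one]
            rw [this, one_pow]
          refine ⟨(orderOf a - 1) * i, _, ?_, by rw [affE_inv, e]⟩
          rw [neg_mul, Units.val_pow_eq_pow_val]
          exact H.neg_mem (pow_closed _ H hH _ h hh) }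
    have : Sgrp (a : F) 0 H ≤ T := by
      unfold Sgrp
      rw [Subgroup.closure_le]
      rintro g (hg | ⟨h, hh, hg⟩)
      · exact ⟨1, 0, H.zero_mem, by rw [pow_one]; exact affE_eq hg⟩
      · exact ⟨0, h, hh, by rw [pow_zero]; exact affE_eq (by simpa using hg)⟩
    exact this hg
  · rintro ⟨i, h, hh, rfl⟩
    have h1 : affE a 0 ∈ Sgrp (a : F) 0 H := Subgroup.subset_closure (Or.inl rfl)
    have h2 : affE 1 h ∈ Sgrp (a : F) 0 H := Subgroup.subset_closure (Or.inr ⟨h, hh, by simp [affE_val]⟩)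
    have h3 : ∀ i : ℕ, affE (a ^ i) (0 : F) ∈ Sgrp (a : F) 0 H := by
      intro i
      induction i with
      | zero => rw [pow_zero, affE_one]; exact Subgroup.one_mem _
      | succ n ih =>
        have := Subgroup.mul_mem _ ih h1
        rw [affE_mul] at this
        simpa [pow_succ] using this
    have := Subgroup.mul_mem _ h2 (h3 i)
    rw [affE_mul] at this
    simpa using this

def trP (M : Subgroup (GL2 F)) : AddSubgroup F where
  carrier := {h | affE 1 h ∈ M}
  zero_mem' := by
    show affE 1 0 ∈ M
    rw [affE_one]; exact M.one_mem
  add_mem' := by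
    intro b c hb hc
    have := M.mul_mem (show affE 1 c ∈ M from hc) (show affE 1 b ∈ M from hb)
    rw [affE_mul] at this
    simpa using this
  neg_mem' := by
    intro b hb
    have := M.inv_mem (show affE 1 b ∈ M from hb)
    rw [affE_inv] at this
    simpa using this

def dgP (M : Subgroup (GL2 F)) : Subgroup Fˣ where
  carrier := {x | ∃ b, affE x b ∈ M}
  one_mem' := ⟨0, by rw [affE_one]; exact M.one_mem⟩
  mul_mem' := by
    rintro x y ⟨b, hb⟩ ⟨c, hc⟩
    exact ⟨_, by rw [← affE_mul]; exact M.mul_mem hb hc⟩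
  inv_mem' := by
    rintro x ⟨b, hb⟩
    exact ⟨_, by rw [← affE_inv]; exact M.inv_mem hb⟩

lemma trP_Sgrp (a : Fˣ) (H : AddSubgroup F) (hH : ∀ h ∈ H, (a : F) * h ∈ H) :
    trP (Sgrp (a : F) 0 H) = H := by
  ext h
  show affE 1 h ∈ Sgrp (a : F) 0 H ↔ h ∈ H
  rw [mem_Sgrp a H hH]
  constructor
  · rintro ⟨i, k, hk, e⟩
    rw [(affE_inj e).2]; exact hk
  · intro hh
    exact ⟨0, h, hh, by rw [pow_zero]⟩

lemma dgP_Sgrp (a : Fˣ) (H : AddSubgroup F) (hH : ∀ h ∈ H, (a : F) * h ∈ H) :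
    Nat.card (dgP (Sgrp (a : F) 0 H)) = orderOf a := by
  have : dgP (Sgrp (a : F) 0 H) = Subgroup.zpowers a := by
    ext x
    rw [mem_zpowers_iff_mem_range_orderOf]
    rw [← mem_powers_iff_mem_range_orderOf, Submonoid.mem_powers_iff]
    show (∃ b, affE x b ∈ Sgrp (a : F) 0 H) ↔ _
    simp only [mem_Sgrp a H hH]
    constructor
    · rintro ⟨b, i, k, hk, e⟩
      exact ⟨i, (affE_inj e).1.symm⟩
    · rintro ⟨i, rfl⟩
      exact ⟨0, i, 0, H.zero_mem, rfl⟩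
  rw [this, Nat.card_zpowers]

lemma mem_clos_pow (a b : Fˣ) (j : ℕ) (h : b = a ^ j) : (b : F) ∈ Subfield.closure {(a : F)} := by
  rw [h, Units.val_pow_eq_pow_val]
  exact pow_mem (Subfield.subset_closure (Set.mem_singleton _)) _

set_option maxHeartbeats 800000 in
/-- structure of subgroups in the interval -/
lemma interval_struct (u : Fˣ) (hu : ∀ x : Fˣ, ∃ k : ℕ, x = u ^ k) (N : ℕ) (hN : N = orderOf u)
    (d1 d0 : ℕ) (hd1 : d1 ∣ d0) (hd0 : d0 ∣ N) (hd1ne : d1 ≠ 1)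
    (H1 H0 : AddSubgroup F)
    (c1 : ∀ h ∈ H1, ((u ^ (N / d1) : Fˣ) : F) * h ∈ H1)
    (c0 : ∀ h ∈ H0, ((u ^ (N / d0) : Fˣ) : F) * h ∈ H0)
    (M : Subgroup (GL2 F)) (h1 : Sgrp ((u ^ (N / d1) : Fˣ) : F) 0 H1 ≤ M)
    (h0 : M ≤ Sgrp ((u ^ (N / d0) : Fˣ) : F) 0 H0) :
    ∃ d H, d1 ∣ d ∧ d ∣ d0 ∧ H1 ≤ H ∧ H ≤ H0 ∧
      (∀ h ∈ H, ((u ^ (N / d) : Fˣ) : F) * h ∈ H) ∧ M = Sgrp ((u ^ (N / d) : Fˣ) : F) 0 H := by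
  have hNpos : 0 < N := hN ▸ orderOf_pos u
  have ord : ∀ d, d ∣ N → orderOf (u ^ (N / d)) = d := by
    rintro d ⟨e, he⟩
    have hdp : 0 < d := Nat.pos_of_ne_zero (by rintro rfl; simp at he; omega)
    have hep : 0 < e := Nat.pos_of_ne_zero (by rintro rfl; simp at he; omega)
    have : N / d = e := by rw [he, Nat.mul_div_cancel_left _ hdp]
    rw [this, orderOf_pow_of_dvd hep.ne' (by rw [← hN, he]; exact dvd_mul_left _ _), ← hN, he,
      Nat.mul_div_cancel _ hep]
  have powr : ∀ d, d ∣ N → ∀ x : Fˣ, x ^ d = 1 → ∃ i : ℕ, x = (u ^ (N / d)) ^ i := by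
    rintro d ⟨e, he⟩ x hx
    have hdp : 0 < d := Nat.pos_of_ne_zero (by rintro rfl; simp at he; omega)
    have : N / d = e := by rw [he, Nat.mul_div_cancel_left _ hdp]
    rw [this]
    obtain ⟨k, rfl⟩ := hu x
    rw [← pow_mul, ← orderOf_dvd_iff_pow_eq_one, ← hN, he, mul_comm k] at hx
    obtain ⟨c, rfl⟩ := Nat.dvd_of_mul_dvd_mul_left hdp hx
    exact ⟨c, by rw [pow_mul]⟩
  set d := Nat.card (dgP M) with hd
  set H := trP M with hH
  -- generator
  obtain ⟨⟨x, hxM⟩, hx⟩ := IsCyclic.exists_generator (α := dgP M)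
  have hxd : orderOf x = d := by
    rw [hd, ← orderOf_eq_card_of_forall_mem_zpowers hx, Subgroup.orderOf_mk]
  have hdN : d ∣ N := by
    obtain ⟨k, rfl⟩ := hu x
    rw [← hxd, hN]
    exact orderOf_pow_dvd k
  have yd : ∀ y ∈ dgP M, y ^ d = 1 := by
    intro y hy
    have : (⟨y, hy⟩ : dgP M) ^ d = 1 := by rw [hd]; exact pow_card_eq_one'
    exact congrArg Subtype.val this
  have ha : u ^ (N / d) ∈ dgP M := by
    have h2 : u ^ (N / d) ∈ Subgroup.zpowers x := by
      obtain ⟨j, hj⟩ := powr d hdN x (by rw [← hxd]; exact pow_orderOf_eq_one x)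
      have : Subgroup.zpowers x = Subgroup.zpowers (u ^ (N / d)) := by
        apply Subgroup.eq_of_le_of_card_ge
        · rw [Subgroup.zpowers_le, hj]
          exact Subgroup.npow_mem_zpowers _ _
        · rw [Nat.card_zpowers, Nat.card_zpowers, ord d hdN, hxd]
      rw [this]; exact Subgroup.mem_zpowers _
    exact (Subgroup.zpowers_le.2 hxM) h2
  have hd1N : d1 ∣ N := hd1.trans hd0
  have ha1M : affE (u ^ (N / d1)) 0 ∈ M :=
    h1 ((mem_Sgrp _ _ c1 _).2 ⟨1, 0, H1.zero_mem, by rw [pow_one]⟩)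
  have hd1d : d1 ∣ d := by
    rw [← ord d1 hd1N, orderOf_dvd_iff_pow_eq_one]
    exact yd _ ⟨_, ha1M⟩
  have hform : ∀ g ∈ M, ∃ y b, g = affE y b ∧ b ∈ H0 ∧ y ^ d0 = 1 := by
    intro g hg
    obtain ⟨i, h, hh, rfl⟩ := (mem_Sgrp _ _ c0 _).1 (h0 hg)
    refine ⟨_, _, rfl, hh, ?_⟩
    rw [← pow_mul, mul_comm i, pow_mul]
    have := pow_orderOf_eq_one (u ^ (N / d0))
    rw [ord d0 hd0] at this
    rw [this, one_pow]
  have hdd0 : d ∣ d0 := by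
    rw [← hxd, orderOf_dvd_iff_pow_eq_one]
    obtain ⟨b, hb⟩ := hxM
    obtain ⟨y, c, e, -, hy⟩ := hform _ hb
    rw [(affE_inj e).1]; exact hy
  have hHc : ∀ h ∈ H, ((u ^ (N / d) : Fˣ) : F) * h ∈ H := by
    intro h hh
    obtain ⟨b, hb⟩ := ha
    have := M.mul_mem (M.mul_mem hb (show affE 1 h ∈ M from hh)) (M.inv_mem hb)
    rw [affE_inv, affE_mul, affE_mul] at this
    show affE 1 _ ∈ M
    convert this using 2 <;> simp
  have key : ∀ y b, affE y b ∈ M → b ∈ H := by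
    intro y b hb
    have h2 := M.mul_mem (M.mul_mem hb ha1M) (M.inv_mem (M.mul_mem ha1M hb))
    rw [affE_mul, affE_mul, affE_inv, affE_mul] at h2
    have h3 : (1 - ((u ^ (N / d1) : Fˣ) : F)) * b ∈ H := by
      show affE 1 _ ∈ M
      convert h2 using 2
      · rw [mul_comm y, mul_inv_cancel]
      · push_cast
        field_simp
        simp only [mul_zero]
        ring
    have hcl := closed_closure _ H hHc
    have hmem : ((u ^ (N / d1) : Fˣ) : F) ∈ Subfield.closure {((u ^ (N / d) : Fˣ) : F)} := by
      obtain ⟨j, hj⟩ := powr d hdN (u ^ (N / d1)) (yd _ ⟨_, ha1M⟩)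
      exact mem_clos_pow _ _ j hj
    have hne : 1 - ((u ^ (N / d1) : Fˣ) : F) ≠ 0 := by
      intro h
      have : (u ^ (N / d1) : Fˣ) = 1 := Units.ext (by rw [Units.val_one]; exact (sub_eq_zero.1 h).symm)
      have h4 := ord d1 hd1N
      rw [this, orderOf_one] at h4
      exact hd1ne h4.symm
    have := hcl _ (inv_mem (sub_mem (one_mem _) hmem)) _ h3
    rwa [inv_mul_cancel_left₀ hne] at this
  refine ⟨d, H, hd1d, hdd0, ?_, ?_, hHc, ?_⟩
  · intro h hh
    exact h1 ((mem_Sgrp _ _ c1 _).2 ⟨0, h, hh, by rw [pow_zero]⟩)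
  · intro h hh
    obtain ⟨y, c, e, hc, -⟩ := hform _ (show affE 1 h ∈ M from hh)
    rw [(affE_inj e).2]; exact hc
  · have hy0 : ∀ y b, affE y b ∈ M → affE y 0 ∈ M := by
      intro y b hb
      have := M.mul_mem (M.inv_mem (show affE 1 b ∈ M from key y b hb)) hb
      rw [affE_inv, affE_mul] at this
      simpa using this
    ext g
    constructor
    · intro hg
      obtain ⟨y, b, rfl, -, -⟩ := hform g hg
      obtain ⟨i, hi⟩ := powr d hdN y (yd y ⟨b, hg⟩)
      exact (mem_Sgrp _ _ hHc _).2 ⟨i, b, key y b hg, by rw [hi]⟩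
    · intro hg
      obtain ⟨i, h, hh, rfl⟩ := (mem_Sgrp _ _ hHc _).1 hg
      obtain ⟨c, hc⟩ := (dgP M).pow_mem ha i
      have := M.mul_mem (show affE 1 h ∈ M from hh) (hy0 _ _ hc)
      rw [affE_mul] at this
      simpa using this
end grp

lemma ord_aux {G : Type} [Group G] [Finite G] (u : G) (N : ℕ) (hN : N = orderOf u) (d : ℕ) (hd : d ∣ N) :
    orderOf (u ^ (N / d)) = d := by
  have hNpos : 0 < N := hN ▸ orderOf_pos u
  obtain ⟨e, he⟩ := hd
  have hdp : 0 < d := Nat.pos_of_ne_zero (by rintro rfl; simp at he; omega)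
  have hep : 0 < e := Nat.pos_of_ne_zero (by rintro rfl; simp at he; omega)
  have : N / d = e := by rw [he, Nat.mul_div_cancel_left _ hdp]
  rw [this, orderOf_pow_of_dvd hep.ne' (by rw [← hN, he]; exact dvd_mul_left _ _), ← hN, he,
    Nat.mul_div_cancel _ hep]

lemma pow_aux {G : Type} [Group G] [Finite G] (u : G) (N : ℕ) (hN : N = orderOf u) (d e : ℕ) (hd : d ∣ e)
    (he : e ∣ N) : u ^ (N / d) = (u ^ (N / e)) ^ (e / d) := by
  have hNpos : 0 < N := hN ▸ orderOf_pos u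
  have hep : 0 < e := Nat.pos_of_dvd_of_pos he hNpos
  have hdp : 0 < d := Nat.pos_of_dvd_of_pos hd hep
  rw [← pow_mul]
  congr 1
  obtain ⟨c, rfl⟩ := hd
  obtain ⟨b, rfl⟩ := he
  rw [Nat.mul_div_cancel_left _ hep, Nat.mul_div_cancel_left _ hdp, mul_assoc,
    Nat.mul_div_cancel_left _ hdp, mul_comm]

section main
variable {F : Type} [Field F] [Fintype F]

noncomputable def nuF (p d1 : ℕ) (H1 : AddSubgroup F) (d : ℕ) (H : AddSubgroup F) : ℤ :=
  ArithmeticFunction.moebius (d / d1) *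
    gw (pPow p d) (Nat.log (pPow p d) (Nat.card H / Nat.card H1))

lemma nu_sum [Fintype (Subgroup (GL2 F))] (p : ℕ) (hp : p.Prime) (hchar : ringChar F = p)
    (u : Fˣ) (hu : ∀ x : Fˣ, ∃ k : ℕ, x = u ^ k) (N : ℕ) (hN : N = orderOf u)
    (d1 d0 : ℕ) (hd1 : d1 ∣ d0) (hd0 : d0 ∣ N) (hd1ne : d1 ≠ 1)
    (H1 H0 : AddSubgroup F) (h10 : H1 ≤ H0)
    (c1 : ∀ h ∈ H1, ((u ^ (N / d0) : Fˣ) : F) * h ∈ H1)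
    (c0 : ∀ h ∈ H0, ((u ^ (N / d0) : Fˣ) : F) * h ∈ H0) :
    ∑ M ∈ Finset.univ.filter (fun M : Subgroup (GL2 F) =>
        Sgrp ((u ^ (N / d1) : Fˣ) : F) 0 H1 ≤ M ∧ M ≤ Sgrp ((u ^ (N / d0) : Fˣ) : F) 0 H0),
      nuF p d1 H1 (Nat.card (dgP M)) (trP M)
    = if Sgrp ((u ^ (N / d1) : Fˣ) : F) 0 H1 = Sgrp ((u ^ (N / d0) : Fˣ) : F) 0 H0 then 1 else 0 := by
  have hNpos : 0 < N := hN ▸ orderOf_pos u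
  have hd0p : 0 < d0 := Nat.pos_of_dvd_of_pos hd0 hNpos
  have : Fintype (AddSubgroup F) := Fintype.ofFinite _
  have ord := ord_aux u N hN
  have cl : ∀ (H : AddSubgroup F) (d e : ℕ), d ∣ e → e ∣ N →
      (∀ h ∈ H, ((u ^ (N / e) : Fˣ) : F) * h ∈ H) → (∀ h ∈ H, ((u ^ (N / d) : Fˣ) : F) * h ∈ H) := by
    intro H d e hde heN hc
    rw [pow_aux u N hN d e hde heN, Units.val_pow_eq_pow_val]
    exact pow_closed _ H hc _
  have c11 := cl H1 d1 d0 hd1 hd0 c1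
  have hiff : Sgrp ((u ^ (N / d1) : Fˣ) : F) 0 H1 = Sgrp ((u ^ (N / d0) : Fˣ) : F) 0 H0
      ↔ d1 = d0 ∧ H1 = H0 := by
    constructor
    · intro h
      refine ⟨?_, ?_⟩
      · rw [← ord d1 (hd1.trans hd0), ← ord d0 hd0, ← dgP_Sgrp _ H1 c11, ← dgP_Sgrp _ H0 c0, h]
      · rw [← trP_Sgrp _ H1 c11, ← trP_Sgrp _ H0 c0, h]
    · rintro ⟨rfl, rfl⟩; rfl
  have step : ∑ M ∈ Finset.univ.filter (fun M : Subgroup (GL2 F) =>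
        Sgrp ((u ^ (N / d1) : Fˣ) : F) 0 H1 ≤ M ∧ M ≤ Sgrp ((u ^ (N / d0) : Fˣ) : F) 0 H0),
      nuF p d1 H1 (Nat.card (dgP M)) (trP M)
      = ∑ x ∈ (d0.divisors.filter (fun d => d1 ∣ d)).sigma (fun d => Finset.univ.filter
        (fun H : AddSubgroup F => (H1 ≤ H ∧ H ≤ H0) ∧ ∀ h ∈ H, ((u ^ (N / d) : Fˣ) : F) * h ∈ H)),
        nuF p d1 H1 x.1 x.2 := by
    symm
    have val : ∀ (d : ℕ) (H : AddSubgroup F), d ∣ N → (∀ h ∈ H, ((u ^ (N / d) : Fˣ) : F) * h ∈ H) →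
        Nat.card (dgP (Sgrp ((u ^ (N / d) : Fˣ) : F) 0 H)) = d ∧ trP (Sgrp ((u ^ (N / d) : Fˣ) : F) 0 H) = H := by
      intro d H hd hH
      exact ⟨by rw [dgP_Sgrp _ H hH, ord d hd], trP_Sgrp _ H hH⟩
    refine Finset.sum_bij (fun x _ => Sgrp ((u ^ (N / x.1) : Fˣ) : F) 0 x.2) ?_ ?_ ?_ ?_
    · rintro ⟨d, H⟩ hx
      simp only [Finset.mem_sigma, Finset.mem_filter, Finset.mem_univ, true_and, Nat.mem_divisors] at hx ⊢
      obtain ⟨⟨⟨hdd0, -⟩, hd1d⟩, ⟨hH1, hH0⟩, hH⟩ := hx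
      have hle : ∀ (d e : ℕ) (H K : AddSubgroup F), d ∣ e → e ∣ N → H ≤ K →
          (∀ h ∈ H, ((u ^ (N / d) : Fˣ) : F) * h ∈ H) → (∀ h ∈ K, ((u ^ (N / e) : Fˣ) : F) * h ∈ K) →
          Sgrp ((u ^ (N / d) : Fˣ) : F) 0 H ≤ Sgrp ((u ^ (N / e) : Fˣ) : F) 0 K := by
        intro d e H K hde he hHK hH hK g hg
        obtain ⟨i, h, hh, rfl⟩ := (mem_Sgrp _ _ hH _).1 hg
        rw [pow_aux u N hN d e hde he, ← pow_mul]
        exact (mem_Sgrp _ _ hK _).2 ⟨_, h, hHK hh, rfl⟩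
      exact ⟨hle d1 d H1 H hd1d (hdd0.trans hd0) hH1 c11 hH, hle d d0 H H0 hdd0 hd0 hH0 hH c0⟩
    · rintro ⟨d, H⟩ hx ⟨d', H'⟩ hx' h
      simp only [Finset.mem_sigma, Finset.mem_filter, Finset.mem_univ, true_and, Nat.mem_divisors] at hx hx'
      obtain ⟨v1, v2⟩ := val d H (hx.1.1.1.trans hd0) hx.2.2
      obtain ⟨v3, v4⟩ := val d' H' (hx'.1.1.1.trans hd0) hx'.2.2
      dsimp only at h
      have e1 : d = d' := by rw [← v1, ← v3, h]
      have e2 : H = H' := by rw [← v2, ← v4, h]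
      rw [e1, e2]
    · intro M hM
      simp only [Finset.mem_filter, Finset.mem_univ, true_and] at hM
      obtain ⟨d, H, a1, a2, a3, a4, a5, rfl⟩ := interval_struct u hu N hN d1 d0 hd1 hd0 hd1ne H1 H0 c11 c0 M hM.1 hM.2
      refine ⟨⟨d, H⟩, ?_, rfl⟩
      simp only [Finset.mem_sigma, Finset.mem_filter, Finset.mem_univ, true_and, Nat.mem_divisors]
      exact ⟨⟨⟨a2, hd0p.ne'⟩, a1⟩, ⟨a3, a4⟩, a5⟩
    · rintro ⟨d, H⟩ hx
      simp only [Finset.mem_sigma, Finset.mem_filter, Finset.mem_univ, true_and, Nat.mem_divisors] at hx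
      obtain ⟨v1, v2⟩ := val d H (hx.1.1.1.trans hd0) hx.2.2
      dsimp only
      rw [v1, v2]
  rw [step, Finset.sum_sigma]
  have inner : ∀ d ∈ d0.divisors.filter (fun d => d1 ∣ d),
      ∑ H ∈ Finset.univ.filter (fun H : AddSubgroup F => (H1 ≤ H ∧ H ≤ H0) ∧
        ∀ h ∈ H, ((u ^ (N / d) : Fˣ) : F) * h ∈ H), nuF p d1 H1 d H
      = ArithmeticFunction.moebius (d / d1) * (if H1 = H0 then 1 else 0) := by
    intro d hd
    simp only [Finset.mem_filter, Nat.mem_divisors] at hd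
    obtain ⟨⟨hdd0, -⟩, hd1d⟩ := hd
    unfold nuF
    rw [← Finset.mul_sum]
    congr 1
    apply inn_sum _ H1 H0 h10 (cl H1 d d0 hdd0 hd0 c1) (cl H0 d d0 hdd0 hd0 c0)
    apply card_closure p hp hchar
    · rw [orderOf_units, ord d (hdd0.trans hd0)]
    · exact Nat.pos_of_dvd_of_pos hdd0 hd0p
  rw [Finset.sum_congr rfl inner, ← Finset.sum_mul, moeb_sum d1 d0 hd0p.ne' hd1]
  simp only [hiff]
  by_cases e1 : d1 = d0 <;> by_cases e2 : H1 = H0 <;> simp [e1, e2]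
end main

lemma mob_unique {P : Type} [PartialOrder P] [Fintype P] (f g : P → ℤ) (K L : P)
    (h : ∀ M, K ≤ M → M ≤ L → ∑ X ∈ Finset.univ.filter (fun X => K ≤ X ∧ X ≤ M), f X
      = ∑ X ∈ Finset.univ.filter (fun X => K ≤ X ∧ X ≤ M), g X) (hKL : K ≤ L) : f L = g L := by
  suffices ∀ M, K ≤ M → M ≤ L → f M = g M from this L hKL le_rfl
  intro M
  induction M using WellFoundedLT.induction with
  | ind M ih =>
    intro hKM hML
    have := h M hKM hML
    have hs : Finset.univ.filter (fun X => K ≤ X ∧ X ≤ M) =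
        insert M (Finset.univ.filter (fun X => K ≤ X ∧ X < M)) := by
      ext X
      simp only [Finset.mem_filter, Finset.mem_univ, true_and, Finset.mem_insert, le_iff_lt_or_eq (b := M)]
      constructor
      · rintro ⟨a, b | b⟩
        · exact Or.inr ⟨a, b⟩
        · exact Or.inl b
      · rintro (rfl | ⟨a, b⟩)
        · exact ⟨hKM, Or.inr rfl⟩
        · exact ⟨a, Or.inl b⟩
    rw [hs, Finset.sum_insert (by simp), Finset.sum_insert (by simp)] at this
    rw [Finset.sum_congr rfl (g := g)] at this
    · exact add_right_cancel this
    · intro X hX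
      simp only [Finset.mem_filter, Finset.mem_univ, true_and] at hX
      exact ih X hX.2 hX.1 (hX.2.le.trans hML)

/-- If `d₁ ≠ 1` and `H₁` is closed under multiplication by the subfield `F_{p(d₂)}`,
then `μ(S₁,S₂) = μ(d₂/d₁) · (-1)^l · p(d₂)^(l(l-1)/2)` where
`l = dim_{F_{p(d₂)}}(H₂/H₁)` (equivalently `|H₂| = |H₁| · p(d₂)^l`). -/
theorem stmt1 (F : Type) [Field F] [Fintype F] (p q : ℕ) (hp : p.Prime)
    (hchar : ringChar F = p) (hq : Fintype.card F = q)
    (γ : F) (hγ0 : γ ≠ 0) (hγ : ∀ x : F, x ≠ 0 → ∃ k : ℕ, x = γ ^ k)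
    (d1 d2 : ℕ) (hd12 : d1 ∣ d2) (hd2 : d2 ∣ q - 1) (hd1ne : d1 ≠ 1)
    (H1 H2 : AddSubgroup F) (hH12 : H1 ≤ H2)
    (hS1 : memS (γ ^ ((q - 1) / d1)) 0 H1)
    (hS2 : memS (γ ^ ((q - 1) / d2)) 0 H2)
    (μ : Subgroup (GL2 F) → Subgroup (GL2 F) → ℤ)
    (hμ : ∀ K L : Subgroup (GL2 F), K ≤ L →
      (∑ᶠ M ∈ {M : Subgroup (GL2 F) | K ≤ M ∧ M ≤ L}, μ K M) = if K = L then 1 else 0)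
    (hmod : ∀ K : Subfield F, Nat.card K = pPow p d2 →
      ∀ x ∈ K, ∀ h ∈ H1, x * h ∈ H1)
    (l : ℕ) (hl : Nat.card H2 = Nat.card H1 * pPow p d2 ^ l) :
    μ (Sgrp (γ ^ ((q - 1) / d1)) 0 H1) (Sgrp (γ ^ ((q - 1) / d2)) 0 H2)
      = ArithmeticFunction.moebius (d2 / d1) * (-1) ^ l
          * (pPow p d2 : ℤ) ^ (l * (l - 1) / 2) := by
  subst hq
  have : Fintype (Subgroup (GL2 F)) := Fintype.ofFinite _
  let u : Fˣ := Units.mk0 γ hγ0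
  have hu : ∀ x : Fˣ, ∃ k : ℕ, x = u ^ k := by
    intro x
    obtain ⟨k, hk⟩ := hγ x x.ne_zero
    exact ⟨k, Units.ext (by simpa [u] using hk)⟩
  set N := Fintype.card F - 1 with hNdef
  have hN : N = orderOf u := by
    rw [orderOf_eq_card_of_forall_mem_zpowers (g := u), Nat.card_eq_fintype_card, Fintype.card_units]
    intro x
    obtain ⟨k, rfl⟩ := hu x
    exact Subgroup.npow_mem_zpowers _ _
  have hNpos : 0 < N := hN ▸ orderOf_pos u
  have hd2p : 0 < d2 := Nat.pos_of_dvd_of_pos hd2 hNpos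
  have hpw : ∀ k, γ ^ k = ((u ^ k : Fˣ) : F) := by intro k; simp [u]
  simp only [hpw] at hS1 hS2 ⊢
  have c2 : ∀ h ∈ H2, ((u ^ (N / d2) : Fˣ) : F) * h ∈ H2 := hS2.2.2 _ (Subfield.subset_closure rfl)
  have hcard : Nat.card (Subfield.closure {((u ^ (N / d2) : Fˣ) : F)}) = pPow p d2 :=
    card_closure p hp hchar _ d2 (by rw [orderOf_units, ord_aux u N hN d2 hd2]) hd2p
  have c1 : ∀ h ∈ H1, ((u ^ (N / d2) : Fˣ) : F) * h ∈ H1 :=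
    hmod _ hcard _ (Subfield.subset_closure rfl)
  have c11 : ∀ h ∈ H1, ((u ^ (N / d1) : Fˣ) : F) * h ∈ H1 := by
    rw [pow_aux u N hN d1 d2 hd12 hd2, Units.val_pow_eq_pow_val]
    exact pow_closed _ H1 c1 _
  have hle : Sgrp ((u ^ (N / d1) : Fˣ) : F) 0 H1 ≤ Sgrp ((u ^ (N / d2) : Fˣ) : F) 0 H2 := by
    intro g hg
    obtain ⟨i, h, hh, rfl⟩ := (mem_Sgrp _ _ c11 _).1 hg
    rw [pow_aux u N hN d1 d2 hd12 hd2, ← pow_mul]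
    exact (mem_Sgrp _ _ c2 _).2 ⟨_, h, hH12 hh, rfl⟩
  have key := mob_unique (μ (Sgrp ((u ^ (N / d1) : Fˣ) : F) 0 H1))
    (fun M => nuF p d1 H1 (Nat.card (dgP M)) (trP M))
    (Sgrp ((u ^ (N / d1) : Fˣ) : F) 0 H1) (Sgrp ((u ^ (N / d2) : Fˣ) : F) 0 H2) (by
      intro M hM1 hM2
      obtain ⟨d, H, a1, a2, a3, a4, a5, rfl⟩ :=
        interval_struct u hu N hN d1 d2 hd12 hd2 hd1ne H1 H2 c11 c2 M hM1 hM2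
      have c1d : ∀ h ∈ H1, ((u ^ (N / d) : Fˣ) : F) * h ∈ H1 := by
        rw [pow_aux u N hN d d2 a2 hd2, Units.val_pow_eq_pow_val]
        exact pow_closed _ H1 c1 _
      rw [nu_sum p hp hchar u hu N hN d1 d a1 (a2.trans hd2) hd1ne H1 H a3 c1d a5, ← hμ _ _ hM1,
        ← finsum_mem_coe_finset]
      simp) hle
  rw [key]
  rw [dgP_Sgrp _ H2 c2, trP_Sgrp _ H2 c2, ord_aux u N hN d2 hd2]
  have h1 : 1 < pPow p d2 := by
    rw [← hcard]
    exact Finite.one_lt_card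
  unfold nuF gw
  rw [hl, Nat.mul_div_cancel_left _ Nat.card_pos, Nat.log_pow h1]
  ring
end

section
/- Let G be a finite p-group (p prime) and let H be a subgroup of G. Then the Möbius function of the subgroup lattice of G satisfies: μ(H,G) = (-1)^α · p^(α(α-1)/2) if H is normal in G and G/H is isomorphic to (Z/pZ)^α for some α ≥ 0, and μ(H,G) = 0 otherwise. -/
set_option linter.style.haveILetI false
open scoped Classical

lemma aux_left {P : Type} [PartialOrder P] [OrderTop P] [Finite P]
    (μ : P → P → ℤ)
    (hμ : ∀ K L : P, K ≤ L →
      (∑ᶠ M ∈ {M : P | K ≤ M ∧ M ≤ L}, μ K M) = if K = L then 1 else 0)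
    (s : Finset P) (K : P) (hs : ∀ M, M ∈ s ↔ K ≤ M) :
    ∑ M ∈ s, μ M ⊤ = if K = ⊤ then 1 else 0 := by
  haveI : Fintype P := Fintype.ofFinite P
  letI : LocallyFiniteOrder P := Fintype.toLocallyFiniteOrder
  have hμ' : ∀ K L : P, K ≤ L → ∑ M ∈ Finset.Icc K L, μ K M = if K = L then 1 else 0 := by
    intro K L h
    rw [← hμ K L h, ← finsum_mem_coe_finset]
    simp [Set.Icc]
  have key : ∀ L K : P, K ≤ L → μ K L = IncidenceAlgebra.mu ℤ K L := by
    intro L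
    induction L using WellFoundedLT.induction with
    | ind L ih =>
      intro K hKL
      have h1 := hμ' K L hKL
      have h2 := IncidenceAlgebra.sum_Icc_mu_right (𝕜 := ℤ) K L
      rw [← h2] at h1
      rw [← Finset.Ico_insert_right hKL, Finset.sum_insert (by simp),
        Finset.sum_insert (by simp)] at h1
      have : ∑ M ∈ Finset.Ico K L, μ K M = ∑ M ∈ Finset.Ico K L, IncidenceAlgebra.mu ℤ K M := by
        apply Finset.sum_congr rfl
        intro M hM
        rw [Finset.mem_Ico] at hM
        exact ih M hM.2 K hM.1
      linarith
  have h3 := IncidenceAlgebra.sum_Icc_mu_left (𝕜 := ℤ) K ⊤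
  rw [← h3]
  have : s = Finset.Icc K ⊤ := by ext M; simp [hs]
  rw [this]
  exact Finset.sum_congr rfl fun M _ => key ⊤ M le_top

lemma aux_frattini {P : Type} [Lattice P] [OrderTop P] [Fintype P]
    (ν : P → ℤ) (hν : ∀ K, ∑ M ∈ Finset.univ.filter (fun M => K ≤ M), ν M = if K = ⊤ then 1 else 0)
    (Φ : P) (hΦ : ∀ K, K ⊔ Φ = ⊤ → K = ⊤) (K : P) (hK : ¬ Φ ≤ K) : ν K = 0 := by
  induction K using WellFoundedGT.induction with
  | ind K ih =>
    have h1 := hν K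
    have h2 := hν (K ⊔ Φ)
    have hKt : K ≠ ⊤ := by rintro rfl; exact hK le_top
    rw [if_neg (fun h => hKt (hΦ K h))] at h2
    rw [if_neg hKt] at h1
    have hsub : insert K (Finset.univ.filter (fun M => K ⊔ Φ ≤ M)) ⊆
        Finset.univ.filter (fun M => K ≤ M) := by
      intro M hM
      simp only [Finset.mem_insert, Finset.mem_filter, Finset.mem_univ, true_and] at hM ⊢
      rcases hM with rfl | hM
      · exact le_rfl
      · exact le_sup_left.trans hM
    rw [← Finset.sum_subset hsub, Finset.sum_insert, h2] at h1
    · simpa using h1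
    · simpa using hK
    · intro M hM hM'
      simp only [Finset.mem_insert, Finset.mem_filter, Finset.mem_univ, true_and, not_or,
        sup_le_iff, not_and] at hM hM'
      exact ih M (lt_of_le_of_ne hM (Ne.symm hM'.1)) (hM'.2 hM)

lemma aux_weisner {P : Type} [Lattice P] [OrderTop P] [Fintype P]
    (ν : P → ℤ) (hν : ∀ K, ∑ M ∈ Finset.univ.filter (fun M => K ≤ M), ν M = if K = ⊤ then 1 else 0)
    (C : P) (hC : C ≠ ⊤) (K : P) (hK : K ≤ C) :
    ∑ M ∈ Finset.univ.filter (fun M => M ⊓ C = K), ν M = 0 := by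
  induction K using WellFoundedGT.induction with
  | ind K ih =>
    have h1 := hν K
    rw [if_neg (by rintro rfl; exact hC (top_le_iff.mp hK))] at h1
    rw [← Finset.sum_fiberwise_of_maps_to (s := Finset.univ.filter (fun M => K ≤ M))
      (t := Finset.univ.filter (fun L => K ≤ L ∧ L ≤ C)) (g := fun M => M ⊓ C)
      (by intro M hM; simp at hM ⊢; exact ⟨hM, hK⟩)] at h1
    rw [Finset.sum_eq_single_of_mem K (by simp [hK])] at h1
    · rw [← h1]
      apply Finset.sum_congr _ (fun _ _ => rfl)
      ext M
      simp only [Finset.mem_filter, Finset.mem_univ, true_and]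
      exact ⟨fun h => ⟨h ▸ inf_le_left, h⟩, fun h => h.2⟩
    · intro L hL hLK
      simp only [Finset.mem_filter, Finset.mem_univ, true_and] at hL
      rw [← ih L (lt_of_le_of_ne hL.1 (Ne.symm hLK)) hL.2]
      apply Finset.sum_congr _ (fun _ _ => rfl)
      ext M
      simp only [Finset.mem_filter, Finset.mem_univ, true_and]
      exact ⟨fun h => h.2, fun h => ⟨hL.1.trans (h ▸ inf_le_left), h⟩⟩

lemma aux_elem (p : ℕ) [Fact p.Prime] (G : Type) [Group G] [Fintype (Subgroup G)]
    (ν : Subgroup G → ℤ)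
    (hν : ∀ K, ∑ M ∈ Finset.univ.filter (fun M => K ≤ M), ν M = if K = ⊤ then 1 else 0)
    (α : ℕ) (f : G →* Multiplicative (Fin α → ZMod p)) (hf : Function.Surjective f) :
    ν f.ker = (-1) ^ α * (p : ℤ) ^ (α * (α - 1) / 2) := by
  induction α with
  | zero =>
    have : f.ker = ⊤ := by
      ext x
      simp only [MonoidHom.mem_ker, Subgroup.mem_top, iff_true]
      exact Subsingleton.elim (α := (Fin 0 → ZMod p)) _ _
    have h := hν ⊤
    rw [this]
    have h2 : Finset.univ.filter (fun M : Subgroup G => ⊤ ≤ M) = {⊤} := by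
      ext M; simp
    rw [h2] at h
    simpa using h
  | succ α ih =>
    let φ : G → Fin (α+1) → ZMod p := fun x => (f x).toAdd
    have φ_mul : ∀ x y, φ (x * y) = φ x + φ y := by intro x y; simp [φ]
    have φ_one : φ 1 = 0 := by simp [φ]
    have φ_inv : ∀ x, φ x⁻¹ = - φ x := by intro x; simp [φ]
    have φ_pow : ∀ x (n : ℕ), φ (x ^ n) = n • φ x := by intro x n; simp [φ]
    have φ_surj : Function.Surjective φ := fun v => hf (Multiplicative.ofAdd v)
    have φ_ker : ∀ x, x ∈ f.ker ↔ φ x = 0 := by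
      intro x; rw [MonoidHom.mem_ker]; rfl
    let C : Subgroup G :=
      { carrier := {x | φ x 0 = 0}
        one_mem' := by simp [φ_one]
        mul_mem' := by intro a b ha hb; simp_all
        inv_mem' := by intro a ha; simp_all }
    have hCm : ∀ x, x ∈ C ↔ φ x 0 = 0 := fun x => Iff.rfl
    let g : (Fin α → ZMod p) → G →* Multiplicative (Fin α → ZMod p) := fun w =>
      { toFun := fun x => Multiplicative.ofAdd (fun i => φ x i.succ - w i * φ x 0)
        map_one' := by simp [φ_one]; rfl
        map_mul' := by
          intro x y
          rw [← ofAdd_add]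
          congr 1
          ext i
          simp [φ_mul]; ring }
    have hgm : ∀ w x, x ∈ (g w).ker ↔ ∀ i : Fin α, φ x i.succ = w i * φ x 0 := by
      intro w x
      rw [MonoidHom.mem_ker]
      change (fun i : Fin α => φ x i.succ - w i * φ x 0) = 0 ↔ _
      rw [funext_iff]
      simp [sub_eq_zero]
    have hgs : ∀ w, Function.Surjective (g w) := by
      intro w v
      obtain ⟨x, hx⟩ := φ_surj (Fin.cons 0 v.toAdd)
      refine ⟨x, ?_⟩
      change Multiplicative.ofAdd (fun i : Fin α => φ x i.succ - w i * φ x 0) = v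
      rw [hx]
      simp
    have hpt : ∀ w, ∃ x, φ x = Fin.cons 1 w := fun w => φ_surj _
    have hCtop : C ≠ ⊤ := by
      intro h
      obtain ⟨x, hx⟩ := hpt 0
      have : x ∈ C := h ▸ Subgroup.mem_top x
      rw [hCm, hx] at this
      simp at this
    have hHC : f.ker ≤ C := by
      intro x hx
      rw [φ_ker] at hx
      rw [hCm, hx]; rfl
    have hW := aux_weisner ν hν C hCtop f.ker hHC
    have hset : Finset.univ.filter (fun M => M ⊓ C = f.ker) =
        insert f.ker (Finset.univ.image (fun w => (g w).ker)) := by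
      ext M
      simp only [Finset.mem_filter, Finset.mem_univ, true_and, Finset.mem_insert, Finset.mem_image]
      constructor
      · intro hM
        by_cases hMH : M = f.ker
        · exact Or.inl hMH
        right
        have hle : f.ker ≤ M := hM ▸ inf_le_left
        obtain ⟨y, hyM, hyH⟩ : ∃ y ∈ M, y ∉ f.ker := by
          by_contra! hcon
          exact hMH (le_antisymm hcon hle)
        have hy0 : φ y 0 ≠ 0 := by
          intro h
          exact hyH (hM ▸ (⟨hyM, h⟩ : y ∈ M ⊓ C))
        let w : Fin α → ZMod p := fun i => φ y i.succ / φ y 0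
        refine ⟨w, ?_⟩
        ext m
        let k : ℕ := (φ m 0 / φ y 0).val
        have hk : ((k : ℕ) : ZMod p) = φ m 0 / φ y 0 := ZMod.natCast_zmod_val _
        have hz0 : φ (m * (y ^ k)⁻¹) 0 = 0 := by
          simp [φ_mul, φ_inv, φ_pow, hk]; field_simp; simp
        have hzi : ∀ i : Fin α, φ (m * (y ^ k)⁻¹) i.succ = φ m i.succ - w i * φ m 0 := by
          intro i
          simp [φ_mul, φ_inv, φ_pow, hk, w]; ring
        have hzM : m * (y ^ k)⁻¹ ∈ M ↔ m ∈ M :=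
          Subgroup.mul_mem_cancel_right _ (inv_mem (pow_mem hyM k))
        have hzk : m * (y ^ k)⁻¹ ∈ f.ker ↔ m ∈ (g w).ker := by
          rw [φ_ker, hgm, funext_iff, Fin.forall_fin_succ]
          simp [hz0, hzi, sub_eq_zero]
        rw [← hzk, ← hzM]
        constructor
        · exact fun h => hle h
        · intro h
          rw [← hM]
          exact ⟨h, hz0⟩
      · rintro (rfl | ⟨w, rfl⟩)
        · exact inf_eq_left.mpr hHC
        · ext x
          rw [Subgroup.mem_inf, hgm, hCm, φ_ker, funext_iff, Fin.forall_fin_succ]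
          constructor
          · rintro ⟨h1, h2⟩
            exact ⟨h2, fun i => by simp [h1, h2]⟩
          · rintro ⟨h1, h2⟩
            exact ⟨fun i => by simp [h1, h2], h1⟩
    have hnot : f.ker ∉ Finset.univ.image (fun w => (g w).ker) := by
      simp only [Finset.mem_image, Finset.mem_univ, true_and, not_exists]
      intro w hw
      obtain ⟨x, hx⟩ := hpt w
      have h1 : x ∈ (g w).ker := by rw [hgm, hx]; simp
      rw [hw, φ_ker, hx] at h1
      simpa using congrFun h1 0
    have hinj : Function.Injective (fun w => (g w).ker) := by
      intro w w' h
      obtain ⟨x, hx⟩ := hpt w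
      have h1 : x ∈ (g w).ker := by rw [hgm, hx]; simp
      have h2 : (g w).ker = (g w').ker := h
      rw [h2, hgm, hx] at h1
      ext i
      simpa using h1 i
    rw [hset, Finset.sum_insert hnot, Finset.sum_image hinj.injOn,
      Finset.sum_congr rfl (fun w _ => ih (g w) (hgs w))] at hW
    simp only [Finset.sum_const, Finset.card_univ, Fintype.card_pi, ZMod.card, Finset.prod_const,
      Fintype.card_fin, nsmul_eq_mul, Nat.cast_pow] at hW
    have he : (α + 1) * (α + 1 - 1) / 2 = α * (α - 1) / 2 + α := by
      rw [← Finset.sum_range_id, Finset.sum_range_succ, Finset.sum_range_id]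
    rw [he, pow_succ (-1 : ℤ) α, pow_add (p : ℤ)]
    linarith

lemma aux_coatom (p : ℕ) [Fact p.Prime] (G : Type) [Group G] [Finite G]
    (hG : IsPGroup p G) (M : Subgroup G) (hM : IsCoatom M) :
    M.Normal ∧ M.index = p := by
  have hp : p.Prime := Fact.out
  haveI := hG.isNilpotent
  refine ⟨Subgroup.NormalizerCondition.normal_of_coatom M Group.normalizerCondition_of_isNilpotent hM, ?_⟩
  obtain ⟨n, hn⟩ := IsPGroup.iff_card.mp (hG.to_subgroup M)
  obtain ⟨N, hN⟩ := IsPGroup.iff_card.mp hG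
  have hlt : n < N := by
    have hle : Nat.card M ≤ Nat.card G := Subgroup.card_le_card_group M
    have hne : Nat.card M ≠ Nat.card G := fun h => hM.1 (Subgroup.card_eq_iff_eq_top M |>.mp h)
    have : p ^ n < p ^ N := by rw [← hn, ← hN]; omega
    exact (Nat.pow_lt_pow_iff_right hp.one_lt).mp this
  obtain ⟨K, hK, hMK⟩ := Sylow.exists_subgroup_card_pow_succ (p := p) (n := n) (G := G)
    (by rw [hN]; exact pow_dvd_pow p hlt) hn
  have hKM : M ≠ K := by
    rintro rfl
    rw [hn] at hK
    have := Nat.pow_right_injective hp.two_le hK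
    omega
  have hKt : K = ⊤ := hM.2 K (lt_of_le_of_ne hMK hKM)
  have h := M.card_mul_index
  rw [hn, ← Subgroup.card_top (G := G), ← hKt, hK, pow_succ] at h
  exact Nat.eq_of_mul_eq_mul_left (pow_pos hp.pos n) h

lemma aux_iso (p : ℕ) [Fact p.Prime] (A : Type) [CommGroup A] [Finite A]
    (hpow : ∀ x : A, x ^ p = 1) :
    ∃ (α : ℕ) (f : A →* (Fin α → Multiplicative (ZMod p))), Function.Bijective f := by
  letI : Module (ZMod p) (Additive A) := AddCommGroup.zmodModule (n := p) (fun x => hpow x.toMul)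
  haveI : Module.Finite (ZMod p) (Additive A) := Module.Finite.of_finite
  let e := (Module.finBasis (ZMod p) (Additive A)).equivFun
  let F : A → (Fin (Module.finrank (ZMod p) (Additive A)) → Multiplicative (ZMod p)) :=
    fun x i => Multiplicative.ofAdd (e (Additive.ofMul x) i)
  refine ⟨_, MonoidHom.mk' F ?_, ?_, ?_⟩
  · intro a b
    funext i
    simp [F]
  · intro a b h
    exact e.injective h
  · intro v
    obtain ⟨y, hy⟩ := e.surjective (fun i => (v i).toAdd)
    exact ⟨y.toMul, hy⟩

lemma aux_quot (p : ℕ) [Fact p.Prime] (G : Type) [Group G] [Finite G] (H : Subgroup G)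
    (hc : commutator G ≤ H) (hpow : ∀ x : G, x ^ p ∈ H) :
    ∃ (α : ℕ) (f : G →* (Fin α → Multiplicative (ZMod p))),
        Function.Surjective f ∧ f.ker = H := by
  haveI : H.Normal := Subgroup.Normal.of_commutator_le G hc
  letI : CommGroup (G ⧸ H) :=
    { QuotientGroup.Quotient.group H with
      mul_comm := by
        intro a b
        induction a using QuotientGroup.induction_on with | H a => ?_
        induction b using QuotientGroup.induction_on with | H b => ?_
        rw [← QuotientGroup.mk_mul, ← QuotientGroup.mk_mul, QuotientGroup.eq]
        apply hc
        have := Subgroup.commutator_mem_commutator (Subgroup.mem_top b⁻¹) (Subgroup.mem_top a⁻¹)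
        rw [commutator_def]
        simpa [commutatorElement_def, mul_assoc] using this }
  obtain ⟨α, f, hf⟩ := aux_iso p (G ⧸ H) (by
    intro x
    obtain ⟨y, rfl⟩ := QuotientGroup.mk_surjective x
    exact (QuotientGroup.eq_one_iff (y ^ p)).mpr (hpow y))
  refine ⟨α, f.comp (QuotientGroup.mk' H), hf.2.comp (QuotientGroup.mk'_surjective H), ?_⟩
  ext x
  rw [MonoidHom.mem_ker, MonoidHom.comp_apply, ← QuotientGroup.eq_one_iff,
    ← hf.1.eq_iff (a := (x : G ⧸ H)), map_one]
  rfl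

/-- P. Hall's formula for the Möbius function of a finite `p`-group `G`:
`μ(H,G) = (-1)^α p^(binom(α,2))` if `H ⊴ G` with `G/H ≅ (ℤ/p)^α`
(i.e. `H` is the kernel of a surjective homomorphism `G → (ℤ/p)^α`),
and `μ(H,G) = 0` otherwise. -/
theorem stmt14 (p : ℕ) (hp : p.Prime) (G : Type) [Group G] [Finite G]
    (hG : IsPGroup p G) (H : Subgroup G)
    (μ : Subgroup G → Subgroup G → ℤ)
    (hμ : ∀ K L : Subgroup G, K ≤ L →
      (∑ᶠ M ∈ {M : Subgroup G | K ≤ M ∧ M ≤ L}, μ K M) = if K = L then 1 else 0) :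
    (∀ (α : ℕ) (f : G →* (Fin α → Multiplicative (ZMod p))),
        Function.Surjective f → f.ker = H →
        μ H ⊤ = (-1) ^ α * (p : ℤ) ^ (α * (α - 1) / 2)) ∧
    ((¬ ∃ (α : ℕ) (f : G →* (Fin α → Multiplicative (ZMod p))),
        Function.Surjective f ∧ f.ker = H) → μ H ⊤ = 0) := by
  haveI : Fact p.Prime := ⟨hp⟩
  haveI : Fintype (Subgroup G) := Fintype.ofFinite _
  have hν : ∀ K : Subgroup G, ∑ M ∈ Finset.univ.filter (fun M => K ≤ M), μ M ⊤ =
      if K = ⊤ then 1 else 0 := fun K => aux_left μ hμ _ K (by simp)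
  constructor
  · intro α f hf hker
    let f' : G →* Multiplicative (Fin α → ZMod p) :=
      MonoidHom.mk' (fun x => Multiplicative.ofAdd (fun i => (f x i).toAdd)) (by
        intro a b
        rw [← ofAdd_add]
        congr 1
        ext i
        simp)
    have hf' : Function.Surjective f' := by
      intro v
      obtain ⟨x, hx⟩ := hf (fun i => Multiplicative.ofAdd (v.toAdd i))
      refine ⟨x, ?_⟩
      change Multiplicative.ofAdd (fun i => (f x i).toAdd) = v
      rw [hx]
      rfl
    have hk : f'.ker = H := by
      rw [← hker]
      ext x
      rw [MonoidHom.mem_ker, MonoidHom.mem_ker]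
      change (fun i => (f x i).toAdd) = 0 ↔ f x = 1
      rw [funext_iff, funext_iff]
      rfl
    rw [← hk]
    exact aux_elem p G (fun M => μ M ⊤) hν α f' hf'
  · intro hno
    let Φ : Subgroup G := commutator G ⊔ Subgroup.closure (Set.range (fun x : G => x ^ p))
    apply aux_frattini (fun M => μ M ⊤) hν Φ
    · intro K hK
      by_contra hKt
      obtain ⟨M, hM, hKM⟩ := (eq_top_or_exists_le_coatom K).resolve_left hKt
      obtain ⟨hMn, hMi⟩ := aux_coatom p G hG M hM
      have hpow : ∀ x : G, x ^ p ∈ M := by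
        intro x
        rw [← hMi]
        exact Subgroup.pow_index_mem M x
      have hcom : commutator G ≤ M := by
        have hcard : Nat.card (G ⧸ M) = p := hMi
        haveI : IsCyclic (G ⧸ M) := isCyclic_of_prime_card hcard
        rw [commutator_def, Subgroup.commutator_le]
        intro a _ b _
        rw [← QuotientGroup.eq_one_iff]
        have : (a : G ⧸ M) * b = b * a := IsCyclic.isMulCommutative.is_comm.comm _ _
        rw [commutatorElement_def]
        rw [QuotientGroup.mk_mul, QuotientGroup.mk_mul, QuotientGroup.mk_mul, this]
        rw [QuotientGroup.mk_inv, QuotientGroup.mk_inv]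
        group
      have hΦM : Φ ≤ M := sup_le hcom ((Subgroup.closure_le M).mpr (by rintro _ ⟨x, rfl⟩; exact hpow x))
      exact hM.1 (top_le_iff.mp (hK ▸ sup_le hKM hΦM))
    · intro hΦ
      exact hno (aux_quot p G H (le_sup_left.trans hΦ)
        (fun x => hΦ (le_sup_right (a := commutator G) (Subgroup.subset_closure ⟨x, rfl⟩))))
end
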